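/- Let (X, d) be a complete metric space, A be a closed set, and f and φ be lower semicontinuous on A. Suppose that (1) f is Lipschitz continuous on Ω_δ∖Ω for some δ > 0, and (2) φ satisfies the generalized Palais–Smale condition on A. Then the penalty function F_λ is (globally) exact if and only if F_λ is exact at every globally optimal solution of the problem (P) and F_μ is bounded below on A for some μ > 0. -/

import Mathlib

open Filter Topology Set

/-- The linear penalty function `F_λ = f + λ φ`. -/
noncomputable def penaltyFun {X : Type*} (f : X → EReal) (φ : X → ℝ) (lam : ℝ) : X → EReal :=
  fun x => f x + ((lam * φ x : ℝ) : EReal)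

/-- The penalty function `F_λ` is (locally) exact at `x`. -/
def ExactPenaltyAt {X : Type*} [TopologicalSpace X] (f : X → EReal) (φ : X → ℝ)
    (A : Set X) (x : X) : Prop :=
  ∃ lam : ℝ, 0 ≤ lam ∧ IsLocalMinOn (penaltyFun f φ lam) A x

/-- The penalty function `F_λ` is globally exact. -/
def GloballyExact {X : Type*} (f : X → EReal) (φ : X → ℝ) (A M : Set X) : Prop :=
  ∃ lam0 : ℝ, 0 ≤ lam0 ∧ ∀ lam : ℝ, lam0 < lam →
    {x | x ∈ A ∧ ∀ y ∈ A, penaltyFun f φ lam x ≤ penaltyFun f φ lam y} =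
      {x | x ∈ M ∩ A ∧ ∀ y ∈ M ∩ A, f x ≤ f y}

/-- The rate of steepest descent `g^↓_A(x)` of a (real-valued) function `g` on the set `A`
at the point `x`. -/
noncomputable def steepestDescentRateOn {X : Type*} [MetricSpace X] (g : X → ℝ)
    (A : Set X) (x : X) : EReal :=
  Filter.liminf (fun y => (((g y - g x) / dist y x : ℝ) : EReal)) (𝓝[A \ {x}] x)

/-- `φ` satisfies the generalized Palais–Smale condition on `A`: every sequence in
`A \ Ω` with `liminf φ(x_n) = 0` and `liminf φ^↓_A(x_n) ≥ 0` has a convergent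
subsequence. -/
def GenPalaisSmale {X : Type*} [MetricSpace X] (φ : X → ℝ) (A M : Set X) : Prop :=
  ∀ x : ℕ → X, (∀ n, x n ∈ A \ (M ∩ A)) →
    Filter.liminf (fun n => ((φ (x n) : ℝ) : EReal)) Filter.atTop = 0 →
    (0 : EReal) ≤ Filter.liminf (fun n => steepestDescentRateOn φ A (x n)) Filter.atTop →
    ∃ z : X, ∃ g : ℕ → ℕ, StrictMono g ∧ Filter.Tendsto (x ∘ g) Filter.atTop (𝓝 z)

/-- Ekeland's variational principle for a real-valued function `g` on `B`, where lower
semicontinuity is replaced by closedness of the sets `{y ∈ B | g y + dist y x ≤ g x}`. -/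
theorem exists_forall_add_dist_le_imp_eq {X : Type*} [MetricSpace X] [CompleteSpace X]
    {g : X → ℝ} {B : Set X} {c : ℝ} (hc : ∀ x ∈ B, c ≤ g x)
    (hcl : ∀ x ∈ B, IsClosed {y | y ∈ B ∧ g y + dist y x ≤ g x}) {x₀ : X} (hx₀ : x₀ ∈ B) :
    ∃ y ∈ B, g y ≤ g x₀ ∧ ∀ w ∈ B, g w + dist w y ≤ g y → w = y := by
  set S : X → Set X := fun x => {y | y ∈ B ∧ g y + dist y x ≤ g x}
  have self_mem : ∀ x ∈ B, x ∈ S x := fun x hx => ⟨hx, by simp⟩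
  have S_subset : ∀ x, ∀ y ∈ S x, S y ⊆ S x := by
    rintro x y ⟨-, hy⟩ w ⟨hwB, hw⟩
    exact ⟨hwB, by linarith [dist_triangle w y x]⟩
  have step : ∀ (k : ℕ) (x : B), ∃ y : B, (y : X) ∈ S x ∧
      ∀ w ∈ S x, g y ≤ g w + 1 / ((k : ℝ) + 1) := by
    rintro k ⟨x, hx⟩
    have hne : (g '' S x).Nonempty := ⟨_, mem_image_of_mem g (self_mem x hx)⟩
    have hbdd : BddBelow (g '' S x) := ⟨c, by rintro _ ⟨w, hw, rfl⟩; exact hc w hw.1⟩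
    obtain ⟨_, ⟨y, hy, rfl⟩, hlt⟩ := exists_lt_of_csInf_lt hne
      (lt_add_of_pos_right (sInf (g '' S x)) (Nat.one_div_pos_of_nat (α := ℝ) (n := k)))
    refine ⟨⟨y, hy.1⟩, hy, fun w hw => ?_⟩
    have := csInf_le hbdd (mem_image_of_mem g hw)
    linarith
  choose next next_mem next_le using step
  let u : ℕ → B := fun n => Nat.rec ⟨x₀, hx₀⟩ (fun k x => next k x) n
  have u_succ : ∀ k, u (k + 1) = next k (u k) := fun _ => rfl
  have anti : Antitone fun k : ℕ => S (u k).1 := by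
    refine antitone_nat_of_succ_le fun k => ?_
    exact S_subset (u k).1 (u (k + 1)).1 (next_mem k (u k))
  have close : ∀ k, ∀ w ∈ S (u (k + 1)), dist w (u (k + 1)) ≤ 1 / ((k : ℝ) + 1) := by
    intro k w hw
    have h₁ := next_le k (u k) w (anti k.le_succ hw)
    rw [← u_succ] at h₁
    linarith [hw.2]
  have mem_S : ∀ {k m : ℕ}, k ≤ m → (u m).1 ∈ S (u k).1 := fun {k m} h =>
    anti h (self_mem (u m).1 (u m).2)
  have cauchy : CauchySeq fun k => (u (k + 1) : X) := by
    refine cauchySeq_of_le_tendsto_0' (fun k : ℕ => 1 / ((k : ℝ) + 1)) (fun n m hnm => ?_)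
      tendsto_one_div_add_atTop_nhds_zero_nat
    rw [dist_comm]
    exact close n _ (mem_S (Nat.succ_le_succ hnm))
  obtain ⟨y, hy⟩ := cauchySeq_tendsto_of_complete cauchy
  have y_mem : ∀ k, y ∈ S (u k).1 := fun k =>
    (hcl _ (u k).2).mem_of_tendsto hy <| by
      filter_upwards [eventually_ge_atTop k] with m hm using mem_S (hm.trans m.le_succ)
  refine ⟨y, (y_mem 0).1, ?_, fun w hwB hw => ?_⟩
  · have h₀ : g y + dist y x₀ ≤ g x₀ := (y_mem 0).2
    linarith [dist_nonneg (x := y) (y := x₀)]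
  · have hw_mem : ∀ k, w ∈ S (u k).1 := fun k => S_subset _ _ (y_mem k) ⟨hwB, hw⟩
    refine tendsto_nhds_unique (tendsto_iff_dist_tendsto_zero.2 ?_) hy
    refine squeeze_zero (fun _ => dist_nonneg) (fun k => ?_)
      (tendsto_one_div_add_atTop_nhds_zero_nat (𝕜 := ℝ))
    rw [dist_comm]
    exact close k w (hw_mem (k + 1))

/-- A weak form of Ekeland's variational principle for extended real-valued functions. -/
theorem LowerSemicontinuousOn.exists_forall_le_add_dist {X : Type*} [MetricSpace X]
    [CompleteSpace X] {F : X → EReal} {A : Set X} (hA : IsClosed A)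
    (hF : LowerSemicontinuousOn F A) {c : ℝ} (hc : ∀ x ∈ A, (c : EReal) ≤ F x) {x₀ : X}
    (hx₀ : x₀ ∈ A) (hx₀_top : F x₀ ≠ ⊤) :
    ∃ y ∈ A, F y ≤ F x₀ ∧ ∀ w ∈ A, F y ≤ F w + (dist w y : ℝ) := by
  set B : Set X := {y | y ∈ A ∧ F y ≠ ⊤}
  have coe_toReal : ∀ y ∈ B, ((F y).toReal : EReal) = F y := fun y hy =>
    EReal.coe_toReal hy.2 (ne_bot_of_le_ne_bot (EReal.coe_ne_bot c) (hc y hy.1))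
  have hcl : ∀ x ∈ B, IsClosed {y | y ∈ B ∧ (F y).toReal + dist y x ≤ (F x).toReal} := by
    intro x hx
    have lsc : LowerSemicontinuousOn (fun y => F y + ((dist y x : ℝ) : EReal)) A :=
      hF.add' ((show Continuous fun y => ((dist y x : ℝ) : EReal) from
        continuous_coe_real_ereal.comp
          (continuous_id.dist continuous_const)).lowerSemicontinuous.lowerSemicontinuousOn A)
        fun y _ => EReal.continuousAt_add (by simp) (by simp)
    obtain ⟨v, hv, hv'⟩ := lowerSemicontinuousOn_iff_preimage_Iic.1 lsc (F x)
    convert hA.inter hv using 1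
    rw [← hv']
    ext y
    constructor
    · rintro ⟨hyB, hy⟩
      refine ⟨hyB.1, ?_⟩
      rw [mem_preimage, mem_Iic, ← coe_toReal x hx, ← coe_toReal y hyB]
      exact_mod_cast hy
    · rintro ⟨hyA, hy⟩
      rw [mem_preimage, mem_Iic] at hy
      have hyB : y ∈ B := ⟨hyA, fun h => hx.2 (by simpa [h] using hy)⟩
      refine ⟨hyB, ?_⟩
      rw [← coe_toReal x hx, ← coe_toReal y hyB] at hy
      exact_mod_cast hy
  obtain ⟨y, hyB, hy, hmin⟩ := exists_forall_add_dist_le_imp_eq (g := fun y => (F y).toReal)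
    (B := B) (c := c) (fun x hx => by
      rw [← EReal.coe_le_coe_iff, coe_toReal x hx]; exact hc x hx.1) hcl ⟨hx₀, hx₀_top⟩
  refine ⟨y, hyB.1, ?_, fun w hw => ?_⟩
  · rw [← coe_toReal y hyB, ← coe_toReal x₀ ⟨hx₀, hx₀_top⟩]
    exact_mod_cast hy
  · by_contra! hlt
    have hwB : w ∈ B := ⟨hw, fun h => by simp [h] at hlt⟩
    have hwy : w = y := hmin w hwB <| by
      rw [← coe_toReal w hwB, ← coe_toReal y hyB] at hlt
      exact_mod_cast hlt.le
    simp [hwy] at hlt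

theorem lowerSemicontinuousOn_penaltyFun {X : Type*} [TopologicalSpace X] {f : X → EReal}
    {φ : X → ℝ} {A : Set X} (hf : LowerSemicontinuousOn f A) (hφ : LowerSemicontinuousOn φ A)
    {lam : ℝ} (hlam : 0 ≤ lam) : LowerSemicontinuousOn (penaltyFun f φ lam) A := by
  have hcont : Continuous fun t : ℝ => ((lam * t : ℝ) : EReal) :=
    continuous_coe_real_ereal.comp (continuous_const.mul continuous_id)
  have hmono : Monotone fun t : ℝ => ((lam * t : ℝ) : EReal) := fun s t hst =>
    EReal.coe_le_coe_iff.2 (mul_le_mul_of_nonneg_left hst hlam)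
  exact hf.add' (hcont.comp_lowerSemicontinuousOn hφ hmono) fun y _ =>
    EReal.continuousAt_add (Or.inr (EReal.coe_ne_bot _)) (Or.inr (EReal.coe_ne_top _))

/-- At an almost critical point of the penalty function near which `f` is Lipschitz on the
infeasible points, `φ` has a small rate of steepest descent. -/
theorem neg_div_le_steepestDescentRateOn {X : Type*} [MetricSpace X] {f : X → EReal}
    {φ : X → ℝ} {A : Set X} {δ L lam : ℝ} {y : X} (hL : 0 ≤ L) (hlam : 0 < lam)
    (hφ : LowerSemicontinuousOn φ A) (hy : y ∈ A) (hy_pos : 0 < φ y) (hy_lt : φ y < δ)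
    (hy_bot : f y ≠ ⊥) (hy_top : f y ≠ ⊤)
    (hLip : ∀ w ∈ A, 0 < φ w → φ w < δ → f w ≤ f y + ((L * dist w y : ℝ) : EReal))
    (hmin : ∀ w ∈ A, penaltyFun f φ lam y ≤ penaltyFun f φ lam w + (dist w y : ℝ)) :
    ((-((L + 1) / lam) : ℝ) : EReal) ≤ steepestDescentRateOn φ A y := by
  refine le_liminf_of_le (by isBoundedDefault) ?_
  have hpos : ∀ᶠ w in 𝓝[A \ {y}] y, 0 < φ w :=
    (hφ y hy 0 hy_pos).filter_mono (nhdsWithin_mono y sdiff_subset)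
  filter_upwards [hpos, self_mem_nhdsWithin] with w hw_pos ⟨hwA, hwy⟩
  have hdist : 0 < dist w y := dist_pos.2 hwy
  rw [EReal.coe_le_coe_iff, le_div_iff₀ hdist, neg_mul, div_mul_eq_mul_div, neg_le, neg_sub,
    le_div_iff₀ hlam]
  rcases le_or_gt δ (φ w) with hw | hw
  · have h₁ : (φ y - φ w) * lam ≤ 0 := mul_nonpos_of_nonpos_of_nonneg (by linarith) hlam.le
    have h₂ : 0 ≤ (L + 1) * dist w y := by positivity
    linarith
  · have h : f y + ((lam * φ y : ℝ) : EReal) ≤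
        f y + ((L * dist w y : ℝ) : EReal) + ((lam * φ w : ℝ) : EReal) + (dist w y : ℝ) := by
      refine (hmin w hwA).trans ?_
      unfold penaltyFun
      gcongr
      exact hLip w hwA hw_pos hw
    lift f y to ℝ using ⟨hy_top, hy_bot⟩ with a
    norm_cast at h
    linarith

theorem penaltyFun_of_eq_zero {X : Type*} {f : X → EReal} {φ : X → ℝ} {x : X} (h : φ x = 0)
    (lam : ℝ) : penaltyFun f φ lam x = f x := by
  simp [penaltyFun, h]

theorem penaltyFun_mono {X : Type*} {f : X → EReal} {φ : X → ℝ} {x : X} (h : 0 ≤ φ x) :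
    Monotone fun lam => penaltyFun f φ lam x := fun a b hab => by
  refine add_le_add_right (EReal.coe_le_coe_iff.2 ?_) _
  exact mul_le_mul_of_nonneg_right hab h

/-- If some penalty function is bounded below by the optimal value, the penalty function is
globally exact. -/
theorem globallyExact_of_forall_le_penaltyFun {X : Type*} {f : X → EReal} {φ : X → ℝ}
    {A M : Set X} (hφ : ∀ x, 0 ≤ φ x) (hM : M = {x | φ x = 0}) {z : X} (hz : z ∈ M ∩ A)
    {m : ℝ} (hzm : f z = m) (hmin : ∀ y ∈ M ∩ A, f z ≤ f y) {lam₀ : ℝ} (hlam₀ : 0 ≤ lam₀)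
    (hle : ∀ x ∈ A, (m : EReal) ≤ penaltyFun f φ lam₀ x) : GloballyExact f φ A M := by
  subst hM
  refine ⟨lam₀, hlam₀, fun lam hlam => ?_⟩
  ext x
  constructor
  · rintro ⟨hxA, hx⟩
    have hxz : penaltyFun f φ lam x ≤ m := by
      simpa only [penaltyFun_of_eq_zero hz.1, hzm] using hx z hz.2
    have hx0 : φ x = 0 := by
      by_contra hne
      have hpos : 0 < φ x := lt_of_le_of_ne (hφ x) (Ne.symm hne)
      have h₀ := hle x hxA
      unfold penaltyFun at hxz h₀
      have htop : f x ≠ ⊤ := fun h => by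
        rw [h, EReal.top_add_coe] at hxz
        exact (EReal.coe_lt_top m).not_ge hxz
      have hbot : f x ≠ ⊥ := fun h => by simp [h] at h₀
      lift f x to ℝ using ⟨htop, hbot⟩ with a
      norm_cast at hxz h₀
      nlinarith
    refine ⟨⟨hx0, hxA⟩, fun y hy => ?_⟩
    rw [penaltyFun_of_eq_zero hx0, ← hzm] at hxz
    exact hxz.trans (hmin y hy)
  · rintro ⟨⟨hx0, hxA⟩, hx⟩
    refine ⟨hxA, fun y hy => ?_⟩
    rw [penaltyFun_of_eq_zero hx0]
    calc f x ≤ f z := hx z hz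
      _ = m := hzm
      _ ≤ penaltyFun f φ lam₀ y := hle y hy
      _ ≤ penaltyFun f φ lam y := penaltyFun_mono (hφ y) hlam.le

/-- If a sequence of points with penalty value below the optimal value, for penalty parameters
tending to infinity, has `φ → 0` and converges, then exactness fails at its limit. -/
theorem not_exactPenaltyAt_of_tendsto {X : Type*} [TopologicalSpace X] {f : X → EReal}
    {φ : X → ℝ} {A : Set X} (hφ : ∀ x, 0 ≤ φ x) {m : EReal} {z : X} (hz : φ z = 0)
    (hzm : f z = m) {y : ℕ → X} {lam : ℕ → ℝ} (hyA : ∀ n, y n ∈ A)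
    (hlam : Tendsto lam atTop atTop) (hlt : ∀ n, penaltyFun f φ (lam n) (y n) < m)
    (hy : Tendsto y atTop (𝓝 z)) : ¬ ExactPenaltyAt f φ A z := by
  rintro ⟨lam₀, -, hloc⟩
  have hyW : Tendsto y atTop (𝓝[A] z) :=
    tendsto_nhdsWithin_iff.2 ⟨hy, Eventually.of_forall hyA⟩
  obtain ⟨n, hn, hn'⟩ := ((hyW.eventually hloc).and (hlam.eventually_ge_atTop lam₀)).exists
  rw [penaltyFun_of_eq_zero hz, hzm] at hn
  exact (hn.trans (penaltyFun_mono (hφ _) hn')).not_gt (hlt n)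

/-- Theorem: in a complete metric space with `A` closed, `f`, `φ` l.s.c. on `A`,
`f` Lipschitz continuous on `Ω_δ \ Ω` for some `δ > 0`, and `φ` satisfying the
generalized Palais–Smale condition on `A`, the penalty function `F_λ` is globally exact
iff it is exact at every globally optimal solution of `(𝒫)` and `F_μ` is bounded below
on `A` for some `μ > 0`. -/
theorem globallyExact_iff_of_palaisSmale {X : Type*} [MetricSpace X] [CompleteSpace X]
    (f : X → EReal) (φ : X → ℝ) (A M : Set X)
    (hAne : A.Nonempty) (hMne : M.Nonempty)
    (hfbot : ∀ x, f x ≠ ⊥) (hφnn : ∀ x, 0 ≤ φ x) (hMdef : M = {x | φ x = 0})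
    (hattain : ∃ z ∈ M ∩ A, (∀ y ∈ M ∩ A, f z ≤ f y) ∧ f z ≠ ⊤)
    (hAclosed : IsClosed A)
    (hflsc : LowerSemicontinuousOn f A)
    (hφlsc : LowerSemicontinuousOn (fun x => (φ x : ℝ)) A)
    (hLip : ∃ δ : ℝ, 0 < δ ∧
      (∀ x ∈ {x | x ∈ A ∧ φ x < δ} \ (M ∩ A), f x ≠ ⊤) ∧
      ∃ L : ℝ, 0 ≤ L ∧ ∀ x ∈ {x | x ∈ A ∧ φ x < δ} \ (M ∩ A),
        ∀ y ∈ {x | x ∈ A ∧ φ x < δ} \ (M ∩ A),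
          f x ≤ f y + ((L * dist x y : ℝ) : EReal))
    (hPS : GenPalaisSmale φ A M) :
    GloballyExact f φ A M ↔
      ((∀ xs : X, xs ∈ M ∩ A → (∀ y ∈ M ∩ A, f xs ≤ f y) → f xs ≠ ⊤ →
          ExactPenaltyAt f φ A xs) ∧
        ∃ μ : ℝ, 0 < μ ∧ ∃ c : ℝ, ∀ x ∈ A, (c : EReal) ≤ penaltyFun f φ μ x) := by
  obtain ⟨z, hz, hzmin, hztop⟩ := hattain
  obtain ⟨m, hm⟩ : ∃ m : ℝ, f z = m := ⟨_, (EReal.coe_toReal hztop (hfbot z)).symm⟩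
  have hφ0 : ∀ {x}, x ∈ M → φ x = 0 := fun hx => by rwa [hMdef] at hx
  constructor
  · rintro ⟨lam₀, hlam₀, hexact⟩
    have hmem : ∀ x ∈ M ∩ A, (∀ y ∈ M ∩ A, f x ≤ f y) →
        ∀ y ∈ A, penaltyFun f φ (lam₀ + 1) x ≤ penaltyFun f φ (lam₀ + 1) y := fun x hx hmin =>
      ((hexact (lam₀ + 1) (by linarith)).ge ⟨hx, hmin⟩).2
    refine ⟨fun x hx hmin _ => ⟨lam₀ + 1, by linarith, ?_⟩, lam₀ + 1, by linarith, m, ?_⟩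
    · filter_upwards [self_mem_nhdsWithin] with y hy using hmem x hx hmin y hy
    · simpa only [penaltyFun_of_eq_zero (hφ0 hz.1), hm] using hmem z hz hzmin
  · rintro ⟨hloc, μ, hμ, c, hc⟩
    obtain ⟨δ, hδ, hfin, L, hL, hLip⟩ := hLip
    by_contra hnot
    have hcm : c ≤ m := by
      have := hc z hz.2
      rw [penaltyFun_of_eq_zero (hφ0 hz.1), hm] at this
      exact_mod_cast this
    set s : ℝ := (m - c) / δ + 1 with hs
    have hs1 : 1 ≤ s := by
      have : 0 ≤ (m - c) / δ := div_nonneg (by linarith) hδ.le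
      linarith
    have hsδ : s * δ = m - c + δ := by rw [hs]; field_simp
    set lam : ℕ → ℝ := fun k => μ + s * (k + 1) with hlam_def
    have hlam_pos : ∀ k, 0 < lam k := fun k => by positivity
    have hlam_ge : ∀ k : ℕ, (k : ℝ) + 1 ≤ lam k := fun k => by
      have : (0 : ℝ) ≤ (k : ℝ) := Nat.cast_nonneg k
      simp only [hlam_def]
      nlinarith
    have hlam_top : Tendsto lam atTop atTop :=
      tendsto_atTop_mono (fun k => (lt_add_one (k : ℝ)).le.trans (hlam_ge k))
        tendsto_natCast_atTop_atTop
    have key : ∀ k : ℕ, ∃ y ∈ A, penaltyFun f φ (lam k) y < m ∧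
        ∀ w ∈ A, penaltyFun f φ (lam k) y ≤ penaltyFun f φ (lam k) w + (dist w y : ℝ) := by
      intro k
      have hμlam : μ ≤ lam k := le_add_of_nonneg_right (by positivity)
      obtain ⟨x, hxA, hx⟩ : ∃ x ∈ A, penaltyFun f φ (lam k) x < m := by
        by_contra! hle
        exact hnot (globallyExact_of_forall_le_penaltyFun hφnn hMdef hz hm hzmin
          (hlam_pos k).le hle)
      obtain ⟨y, hyA, hyx, hy⟩ := (lowerSemicontinuousOn_penaltyFun hflsc hφlsc
        (hlam_pos k).le).exists_forall_le_add_dist hAclosed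
        (fun w hw => (hc w hw).trans (penaltyFun_mono (hφnn w) hμlam)) hxA hx.ne_top
      exact ⟨y, hyA, hyx.trans_lt hx, hy⟩
    choose y hyA hy_lt hy_min using key
    have hyf : ∀ k, f (y k) < m := fun k => by
      have h := (penaltyFun_mono (f := f) (hφnn (y k)) (hlam_pos k).le).trans_lt (hy_lt k)
      simpa [penaltyFun] using h
    have hyM : ∀ k, y k ∉ M ∩ A := fun k hk =>
      ((hzmin _ hk).trans_lt (hyf k)).ne hm
    have hnotM : ∀ {x}, 0 < φ x → x ∉ M ∩ A := fun h hx => h.ne' (hφ0 hx.1)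
    have hy_pos : ∀ k, 0 < φ (y k) := fun k =>
      lt_of_le_of_ne (hφnn _) fun h => hyM k ⟨by rw [hMdef]; exact h.symm, hyA k⟩
    have hy_bound : ∀ k : ℕ, s * (k + 1) * φ (y k) ≤ m - c := fun k => by
      have h₁ := hy_lt k
      have h₂ := hc _ (hyA k)
      have h₃ := (hyf k).ne_top
      have h₄ := hfbot (y k)
      unfold penaltyFun at h₁ h₂
      lift f (y k) to ℝ using ⟨h₃, h₄⟩ with a
      norm_cast at h₁ h₂
      simp only [hlam_def] at h₁
      linarith
    have hy_le : ∀ k : ℕ, φ (y k) ≤ (m - c) / (k + 1) := fun k => by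
      rw [le_div_iff₀ (by positivity)]
      have := hy_bound k
      have h₁ : 0 ≤ (s - 1) * ((k + 1) * φ (y k)) :=
        mul_nonneg (by linarith) (mul_nonneg (by positivity) (hφnn _))
      linarith
    have hy_δ : ∀ k, φ (y k) < δ := fun k => by
      by_contra! hle
      have h₁ : s * δ ≤ s * φ (y k) := mul_le_mul_of_nonneg_left hle (by linarith)
      have h₂ : 0 ≤ s * φ (y k) * k :=
        mul_nonneg (mul_nonneg (by linarith) (hφnn _)) (Nat.cast_nonneg k)
      linarith [hy_bound k]
    have tendsto_const_div : ∀ a : ℝ, Tendsto (fun k : ℕ => a / ((k : ℝ) + 1)) atTop (𝓝 0) :=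
      fun a => by
        simpa [div_eq_mul_inv] using
          (tendsto_one_div_add_atTop_nhds_zero_nat (𝕜 := ℝ)).const_mul a
    have hφ_tendsto : Tendsto (fun k => φ (y k)) atTop (𝓝 0) :=
      squeeze_zero (fun _ => hφnn _) hy_le (tendsto_const_div _)
    have hrate : ∀ k : ℕ, ((-((L + 1) / ((k : ℝ) + 1)) : ℝ) : EReal) ≤
        steepestDescentRateOn φ A (y k) := fun k => by
      refine le_trans (EReal.coe_le_coe_iff.2 (neg_le_neg ?_))
        (neg_div_le_steepestDescentRateOn hL (hlam_pos k) hφlsc (hyA k) (hy_pos k) (hy_δ k)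
          (hfbot _) (hyf k).ne_top (fun w hwA hw hwδ => hLip w ⟨⟨hwA, hwδ⟩, hnotM hw⟩ _
            ⟨⟨hyA k, hy_δ k⟩, hyM k⟩) (hy_min k))
      exact div_le_div_of_nonneg_left (by linarith) (by positivity) (hlam_ge k)
    obtain ⟨x, g, hg, hgx⟩ := hPS y (fun k => ⟨hyA k, hyM k⟩)
      (((continuous_coe_real_ereal.tendsto 0).comp hφ_tendsto).liminf_eq.trans EReal.coe_zero)
      (by
        have h := (continuous_coe_real_ereal.tendsto _).comp (tendsto_const_div (L + 1)).neg
        rw [neg_zero, EReal.coe_zero] at h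
        rw [← h.liminf_eq]
        exact liminf_le_liminf (Eventually.of_forall hrate))
    have hxA : x ∈ A := hAclosed.mem_of_tendsto hgx (Eventually.of_forall fun _ => hyA _)
    have hgx' : Tendsto (y ∘ g) atTop (𝓝[A] x) :=
      tendsto_nhdsWithin_iff.2 ⟨hgx, Eventually.of_forall fun _ => hyA _⟩
    have hx0 : φ x = 0 := by
      refine le_antisymm (le_of_not_gt fun hpos => ?_) (hφnn x)
      obtain ⟨k, hk, hk'⟩ := ((hgx'.eventually (hφlsc x hxA _ (half_lt_self hpos))).and
        ((hφ_tendsto.comp hg.tendsto_atTop).eventually_lt_const (half_pos hpos))).exists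
      exact lt_asymm hk hk'
    have hxM : x ∈ M ∩ A := ⟨by rw [hMdef]; exact hx0, hxA⟩
    have hfx : f x = m := by
      refine le_antisymm (le_of_not_gt fun hgt => ?_) (hm ▸ hzmin x hxM)
      obtain ⟨k, hk⟩ := (hgx'.eventually (hflsc x hxA _ hgt)).exists
      exact lt_asymm hk (hyf _)
    exact not_exactPenaltyAt_of_tendsto hφnn hx0 hfx (fun _ => hyA _)
      (hlam_top.comp hg.tendsto_atTop) (fun k => hy_lt (g k)) hgx
      (hloc x hxM (fun w hw => hfx.trans_le (hm ▸ hzmin w hw)) (by simp [hfx]))
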